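/- Let S̃_1,…,S̃_n and Σ̃_1,…,Σ̃_n be symmetric positive semidefinite (p+1)×(p+1) real matrices and δ = max_i ‖S̃_i − Σ̃_i‖_∞. Let α > 2, λ > 0, and let (β̂_1,…,β̂_n) be a minimizer over (ℝ^p)^n of Σ_{i=1}^n [ m β̃_i^T S̃_i β̃_i + λ ‖β̃_i‖_1^α ]. For each i let β_{0i} ∈ ℝ^p minimize β ↦ β̃^T Σ̃_i β̃ over ℝ^p. Then Σ_{i=1}^n β̂̃_i^T Σ̃_i β̂̃_i + (λ/m) Σ_{i=1}^n ‖β̂̃_i‖_1^α − δ Σ_{i=1}^n ‖β̂̃_i‖_1² ≤ Σ_{i=1}^n β̃_{0i}^T Σ̃_i β̃_{0i} + (λ/m) Σ_{i=1}^n ‖β̃_{0i}‖_1^α + δ Σ_{i=1}^n ‖β̃_{0i}‖_1². -/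

import Mathlib

open Matrix

/-- ℓ1 norm of a vector. -/
noncomputable def l1 {q : ℕ} (v : Fin q → ℝ) : ℝ := ∑ ℓ, |v ℓ|

/-- `β̃ = (−1, βᵀ)ᵀ`. -/
noncomputable def tl {p : ℕ} (v : Fin p → ℝ) : Fin (p + 1) → ℝ := Fin.cons (-1) v

/-- Quadratic form `vᵀ S v`. -/
noncomputable def qf {q : ℕ} (S : Matrix (Fin q) (Fin q) ℝ) (v : Fin q → ℝ) : ℝ :=
  v ⬝ᵥ S.mulVec v

/-- Maximal absolute value of an entry of a matrix. -/
noncomputable def supNorm {a b : ℕ} (A : Matrix (Fin a) (Fin b) ℝ) : ℝ :=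
  ⨆ kl : Fin a × Fin b, |A kl.1 kl.2|

theorem qf_diff_le {q : ℕ} (A B : Matrix (Fin q) (Fin q) ℝ) (d : ℝ)
    (h : supNorm (A - B) ≤ d) (v : Fin q → ℝ) : |qf A v - qf B v| ≤ d * (l1 v) ^ 2 := by
  have he : ∀ i j, |(A - B) i j| ≤ d := fun i j =>
    (le_ciSup (f := fun kl : Fin q × Fin q => |(A - B) kl.1 kl.2|)
      (Set.finite_range _).bddAbove (i, j)).trans h
  have e1 : qf A v - qf B v = ∑ i, ∑ j, v i * ((A - B) i j * v j) := by
    unfold qf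
    rw [← dotProduct_sub, ← Matrix.sub_mulVec]
    simp only [dotProduct, Matrix.mulVec, Finset.mul_sum]
  have e2 : d * (l1 v) ^ 2 = ∑ i, ∑ j, |v i| * (d * |v j|) := by
    unfold l1
    rw [sq, Finset.sum_mul_sum, Finset.mul_sum]
    refine Finset.sum_congr rfl fun i _ => ?_
    rw [Finset.mul_sum]
    exact Finset.sum_congr rfl fun j _ => by ring
  rw [e1, e2]
  refine (Finset.abs_sum_le_sum_abs _ _).trans (Finset.sum_le_sum fun i _ => ?_)
  refine (Finset.abs_sum_le_sum_abs _ _).trans (Finset.sum_le_sum fun j _ => ?_)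
  rw [abs_mul, abs_mul]
  exact mul_le_mul_of_nonneg_left
    (mul_le_mul_of_nonneg_right (he i j) (abs_nonneg _)) (abs_nonneg _)

theorem stmt5 {n p : ℕ} (m : ℕ) (hm : 1 ≤ m) (α lam : ℝ) (hα : 2 < α) (hlam : 0 < lam)
    (S Sg : Fin n → Matrix (Fin (p + 1)) (Fin (p + 1)) ℝ)
    (hS : ∀ i, (S i).PosSemidef) (hSg : ∀ i, (Sg i).PosSemidef)
    (δ : ℝ) (hδ : δ = ⨆ i : Fin n, supNorm (S i - Sg i))
    (βhat : Fin n → Fin p → ℝ)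
    (hmin : ∀ b : Fin n → Fin p → ℝ,
      (∑ i, ((m : ℝ) * qf (S i) (tl (βhat i)) + lam * (l1 (tl (βhat i))) ^ α)) ≤
      (∑ i, ((m : ℝ) * qf (S i) (tl (b i)) + lam * (l1 (tl (b i))) ^ α)))
    (β0 : Fin n → Fin p → ℝ)
    (hβ0 : ∀ i, ∀ β : Fin p → ℝ, qf (Sg i) (tl (β0 i)) ≤ qf (Sg i) (tl β)) :
    (∑ i, qf (Sg i) (tl (βhat i)))
        + (lam / m) * (∑ i, (l1 (tl (βhat i))) ^ α)
        - δ * (∑ i, (l1 (tl (βhat i))) ^ 2) ≤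
      (∑ i, qf (Sg i) (tl (β0 i)))
        + (lam / m) * (∑ i, (l1 (tl (β0 i))) ^ α)
        + δ * (∑ i, (l1 (tl (β0 i))) ^ 2) := by
  have hd : ∀ i, supNorm (S i - Sg i) ≤ δ := fun i => by
    rw [hδ]
    exact le_ciSup (f := fun i => supNorm (S i - Sg i)) (Set.finite_range _).bddAbove i
  have hm0 : (0 : ℝ) < m := by exact_mod_cast hm
  have h1 : ∑ i, qf (Sg i) (tl (βhat i)) ≤
      ∑ i, qf (S i) (tl (βhat i)) + δ * ∑ i, (l1 (tl (βhat i))) ^ 2 := by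
    rw [Finset.mul_sum, ← Finset.sum_add_distrib]
    refine Finset.sum_le_sum fun i _ => ?_
    have := (abs_le.1 (qf_diff_le _ _ _ (hd i) (tl (βhat i)))).1
    linarith
  have h2 : ∑ i, qf (S i) (tl (β0 i)) ≤
      ∑ i, qf (Sg i) (tl (β0 i)) + δ * ∑ i, (l1 (tl (β0 i))) ^ 2 := by
    rw [Finset.mul_sum, ← Finset.sum_add_distrib]
    refine Finset.sum_le_sum fun i _ => ?_
    have := (abs_le.1 (qf_diff_le _ _ _ (hd i) (tl (β0 i)))).2
    linarith
  have h3 := hmin β0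
  simp only [Finset.sum_add_distrib, ← Finset.mul_sum] at h3
  have h4 : ∑ i, qf (S i) (tl (βhat i)) + (lam / m) * ∑ i, (l1 (tl (βhat i))) ^ α ≤
      ∑ i, qf (S i) (tl (β0 i)) + (lam / m) * ∑ i, (l1 (tl (β0 i))) ^ α := by
    refine le_of_mul_le_mul_left ?_ hm0
    have e : ∀ x y : ℝ, (m : ℝ) * (x + lam / m * y) = m * x + lam * y := fun x y => by
      field_simp
    rw [e, e]
    exact h3
  linarith
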